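/- In the insurance setting with finitely many states, a new contract α̂ : Θ → ℝ must be acceptable if and only if there exists λ ∈ (0,1] such that α̂(θ) ≥ λ·α(θ) + (1−λ)·v(θ) for every θ ∈ Θ. -/

import Mathlib

/-- A weak-preference implication under all probability vectors, tested on the two-point vector
that makes the consumer indifferent between `a` and `v`. -/
lemma cross_mul_le_of_forall_prob {Θ : Type*} [Fintype Θ] {v a b : Θ → ℝ}
    (h : ∀ μ : Θ → ℝ, (∀ θ, 0 ≤ μ θ) → (∑ θ, μ θ) = 1 →
      ∑ θ, μ θ * a θ ≥ ∑ θ, μ θ * v θ → ∑ θ, μ θ * b θ ≥ ∑ θ, μ θ * v θ)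
    {s t : Θ} (hs : v s < a s) (ht : a t < v t) :
    (a s - v s) * (v t - b t) ≤ (v t - a t) * (b s - v s) := by
  classical
  set p := v t - a t with hp
  set q := a s - v s with hq
  have hp0 : 0 < p := sub_pos.2 ht
  have hq0 : 0 < q := sub_pos.2 hs
  let μ : Θ → ℝ := fun θ => (if θ = s then p / (p + q) else 0) + if θ = t then q / (p + q) else 0
  have hsum (f : Θ → ℝ) : ∑ θ, μ θ * f θ = (p * f s + q * f t) / (p + q) := by
    simp only [μ, add_mul, ite_mul, zero_mul, Finset.sum_add_distrib, Finset.sum_ite_eq',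
      Finset.mem_univ, if_true]
    ring
  have hμ : ∀ θ, 0 ≤ μ θ := fun θ => by
    simp only [μ]
    split_ifs <;> positivity
  have hone : ∑ θ, μ θ = 1 := by
    have := hsum fun _ => 1
    simp only [mul_one] at this
    rw [this, div_self (by positivity)]
  have key := h μ hμ hone
  rw [hsum, hsum, hsum, ge_iff_le, ge_iff_le, div_le_div_iff_of_pos_right (by positivity),
    div_le_div_iff_of_pos_right (by positivity)] at key
  have := key (by rw [hp, hq]; linarith)
  linarith

/-- The utility with a kink at `k`, of slope `K + 1` below it and `1` above it. -/
def kinkedUtility (K k x : ℝ) : ℝ := K * min x k + x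

lemma strictMono_kinkedUtility {K : ℝ} (hK : 0 ≤ K) (k : ℝ) : StrictMono (kinkedUtility K k) :=
  fun _ _ hxy => add_lt_add_of_le_of_lt
    (mul_le_mul_of_nonneg_left (min_le_min_right k hxy.le) hK) hxy

lemma concaveOn_kinkedUtility {K : ℝ} (hK : 0 ≤ K) (k : ℝ) :
    ConcaveOn ℝ Set.univ (kinkedUtility K k) :=
  ((((concaveOn_id convex_univ).inf (concaveOn_const k convex_univ)).smul hK).add
    (concaveOn_id convex_univ))

lemma continuous_kinkedUtility (K k : ℝ) : Continuous (kinkedUtility K k) := by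
  unfold kinkedUtility
  fun_prop

/-- Since the kinked utility can be arbitrarily steep below `a₁`, gains above `a₁` cannot
compensate for a payoff below `a₂`. -/
lemma le_of_kinkedUtility_cross_mul_le {v₁ a₁ b₁ v₂ a₂ b₂ : ℝ} (h₁ : v₁ < a₁) (h₂ : a₂ < v₂)
    (h : ∀ K, 0 ≤ K →
      (kinkedUtility K a₁ a₁ - kinkedUtility K a₁ v₁) *
          (kinkedUtility K a₁ v₂ - kinkedUtility K a₁ b₂) ≤
        (kinkedUtility K a₁ v₂ - kinkedUtility K a₁ a₂) *
          (kinkedUtility K a₁ b₁ - kinkedUtility K a₁ v₁)) :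
    a₂ ≤ b₂ := by
  by_contra! hb
  have hd : 0 < a₁ - v₁ := sub_pos.2 h₁
  have he : 0 < a₂ - b₂ := sub_pos.2 hb
  have hf : 0 < v₂ - a₂ := sub_pos.2 h₂
  set c := |b₁ - a₁| with hc
  set K := c * (v₂ - a₂) / ((a₁ - v₁) * (a₂ - b₂)) with hKdef
  have hK : 0 ≤ K := by positivity
  have hKeq : K * ((a₁ - v₁) * (a₂ - b₂)) = c * (v₂ - a₂) := by
    rw [hKdef]
    field_simp
  have key := h K hK
  set u := kinkedUtility K a₁ with hu
  have hslope := (concaveOn_kinkedUtility hK a₁).slope_anti_adjacent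
    (Set.mem_univ b₂) (Set.mem_univ v₂) hb h₂
  rw [← hu, div_le_div_iff₀ hf he] at hslope
  have hP : 0 < u v₂ - u a₂ := sub_pos.2 (strictMono_kinkedUtility hK a₁ h₂)
  have hQ : u a₁ - u v₁ = (K + 1) * (a₁ - v₁) := by
    simp only [hu, kinkedUtility, min_self, min_eq_left h₁.le]
    ring
  have hR : u b₁ - u a₁ ≤ c := by
    have h₃ : K * min b₁ a₁ ≤ K * a₁ := mul_le_mul_of_nonneg_left (min_le_right _ _) hK
    have h₄ : b₁ - a₁ ≤ c := le_abs_self _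
    simp only [hu, kinkedUtility, min_self]
    linarith
  have hle : (K + 1) * (a₁ - v₁) * (u a₂ - u b₂) ≤ (u v₂ - u a₂) * c := by
    rw [← hQ]
    linarith [mul_le_mul_of_nonneg_left hR hP.le]
  have h₅ := mul_le_mul_of_nonneg_left hslope (by positivity : 0 ≤ (K + 1) * (a₁ - v₁))
  have h₆ := mul_le_mul_of_nonneg_right hle hf.le
  have h₇ : 0 < (u v₂ - u a₂) * ((a₁ - v₁) * (a₂ - b₂)) := by positivity
  have h₈ : (u v₂ - u a₂) * (K * ((a₁ - v₁) * (a₂ - b₂))) =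
      (u v₂ - u a₂) * (c * (v₂ - a₂)) := by rw [hKeq]
  linarith

/-- Remark (insurance, finitely many states): a new contract `αhat` must be
acceptable—i.e., for every strictly increasing, concave, continuous utility
and every probability vector over states, weak (resp. strict) preference for
the status quo policy `α` over no insurance `v` implies weak (resp. strict)
preference for `αhat` over `v`—iff `αhat` weakly dominates a nontrivial
convex combination of `α` and `v`. -/
theorem insurance_must_accept_iff {Θ : Type*} [Fintype Θ]
    (v α αhat : Θ → ℝ)
    (h1 : ∃ θ, α θ > v θ) (h2 : ∃ θ, α θ < v θ) :
    (∀ u : ℝ → ℝ, StrictMono u → ConcaveOn ℝ Set.univ u → Continuous u →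
      ∀ μ : Θ → ℝ, (∀ θ, 0 ≤ μ θ) → (∑ θ, μ θ) = 1 →
        ((∑ θ, μ θ * u (α θ) ≥ ∑ θ, μ θ * u (v θ) →
            ∑ θ, μ θ * u (αhat θ) ≥ ∑ θ, μ θ * u (v θ)) ∧
          (∑ θ, μ θ * u (α θ) > ∑ θ, μ θ * u (v θ) →
            ∑ θ, μ θ * u (αhat θ) > ∑ θ, μ θ * u (v θ)))) ↔
      ∃ l ∈ Set.Ioc (0 : ℝ) 1, ∀ θ, αhat θ ≥ l * α θ + (1 - l) * v θ := by
  classical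
  constructor
  · intro h
    have point (θ : Θ) := h id strictMono_id (concaveOn_id convex_univ) continuous_id
      (Pi.single θ 1) (fun x => by by_cases hx : x = θ <;> simp [hx])
      (by simp)
    simp only [id, Pi.single_apply, ite_mul, one_mul, zero_mul, Finset.sum_ite_eq',
      Finset.mem_univ, if_true] at point
    have hlin {s t : Θ} (hs : v s < α s) (ht : α t < v t) :
        (α s - v s) * (v t - αhat t) ≤ (v t - α t) * (αhat s - v s) :=
      cross_mul_le_of_forall_prob (fun μ hμ hone =>
        (h id strictMono_id (concaveOn_id convex_univ) continuous_id μ hμ hone).1) hs ht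
    obtain ⟨r, hr⟩ := h1
    have hlow {t : Θ} (ht : α t < v t) : α t ≤ αhat t :=
      le_of_kinkedUtility_cross_mul_le hr ht fun K hK =>
        have hu := strictMono_kinkedUtility hK (α r)
        cross_mul_le_of_forall_prob (v := fun θ => kinkedUtility K (α r) (v θ))
          (a := fun θ => kinkedUtility K (α r) (α θ))
          (b := fun θ => kinkedUtility K (α r) (αhat θ))
          (fun μ hμ hone => (h _ hu (concaveOn_kinkedUtility hK _)
            (continuous_kinkedUtility K _) μ hμ hone).1) (hu hr) (hu ht)
    obtain ⟨s, hs, hmin⟩ := Finset.exists_min_image (Finset.univ.filter fun θ => v θ < α θ)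
      (fun θ => (αhat θ - v θ) / (α θ - v θ)) ⟨r, by simpa using hr⟩
    simp only [Finset.mem_filter, Finset.mem_univ, true_and] at hs hmin
    have hs' : 0 < α s - v s := sub_pos.2 hs
    set m := (αhat s - v s) / (α s - v s) with hm
    have hm0 : 0 < m := div_pos (sub_pos.2 ((point s).2 hs)) hs'
    refine ⟨min 1 m, ⟨lt_min one_pos hm0, min_le_left _ _⟩, fun θ => ?_⟩
    rcases lt_trichotomy (α θ) (v θ) with hθ | hθ | hθ
    · rcases min_choice 1 m with hl | hl <;> rw [hl]
      · linarith [hlow hθ]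
      · have h₁ : v θ - αhat θ ≤ (v θ - α θ) * m := by
          rw [hm, ← mul_div_assoc, le_div_iff₀ hs']
          linarith [hlin hs hθ]
        linarith
    · have := (point θ).1 hθ.ge
      rw [hθ]
      linarith
    · have h₁ : min 1 m ≤ _ := (min_le_right 1 m).trans (hmin θ hθ)
      rw [le_div_iff₀ (sub_pos.2 hθ)] at h₁
      linarith
  · rintro ⟨l, ⟨hl0, hl1⟩, hl⟩ u hmono hconc - μ hμ -
    have hle : l * ∑ θ, μ θ * u (α θ) + (1 - l) * ∑ θ, μ θ * u (v θ) ≤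
        ∑ θ, μ θ * u (αhat θ) := by
      rw [Finset.mul_sum, Finset.mul_sum, ← Finset.sum_add_distrib]
      refine Finset.sum_le_sum fun θ _ => ?_
      have h₁ : l * u (α θ) + (1 - l) * u (v θ) ≤ u (αhat θ) :=
        (hconc.2 (Set.mem_univ _) (Set.mem_univ _) hl0.le (sub_nonneg.2 hl1)
          (by ring)).trans (hmono.monotone (hl θ))
      linarith [mul_le_mul_of_nonneg_left h₁ (hμ θ)]
    constructor <;> intro hα
    · linarith [mul_le_mul_of_nonneg_left hα hl0.le]
    · linarith [mul_lt_mul_of_pos_left hα hl0]
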